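/- Fix an integer d ≥ 1 and complex parameters ρ, σ such that ρ + m ≠ 0 for all integers 1 ≤ m ≤ d and ρ − σ − m ≠ 0 for all integers 1 ≤ m ≤ d. Then for all integers 0 ≤ x ≤ d − 1 and 0 ≤ i ≤ d − 1, the following contiguity relation for the normalized dual Hahn functions holds: (d + σ − ρ) · p_{x,i}(d; ρ, σ) = −(i + ρ − σ − d) · p_{x,i}(d−1; ρ, σ) + (i + ρ) · p_{x,i−1}(d−1; ρ, σ). -/

import Mathlib

/-- Pochhammer symbol `(a)_k = a (a+1) ⋯ (a+k-1)`. -/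
noncomputable def poch (a : ℂ) (k : ℕ) : ℂ := ∏ l ∈ Finset.range k, (a + l)

/-- Normalized dual Hahn function `p_{x,i}(d; ρ, σ)`, with the convention that it
vanishes for negative `i`. -/
noncomputable def dualHahnP (d : ℕ) (ρ σ : ℂ) (x : ℕ) (i : ℤ) : ℂ :=
  if i < 0 then 0
  else
    (-1 : ℂ) ^ i.toNat * (d.choose i.toNat : ℂ) * poch (ρ + 1) i.toNat /
        poch (ρ - σ - (d : ℂ)) i.toNat *
      ∑ k ∈ Finset.range (min i.toNat x + 1),
        poch (-(i.toNat : ℂ)) k * poch (-(x : ℂ)) k * poch ((x : ℂ) + 1 + σ) k /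
          (poch (ρ + 1) k * poch (-(d : ℂ)) k * (k.factorial : ℂ))

theorem poch_succ (a : ℂ) (k : ℕ) : poch a (k + 1) = poch a k * (a + k) :=
  Finset.prod_range_succ _ _

theorem poch_succ' (a : ℂ) (k : ℕ) : poch a (k + 1) = a * poch (a + 1) k := by
  simp only [poch, Finset.prod_range_succ', Nat.cast_zero, add_zero]
  rw [mul_comm]
  congr 1
  refine Finset.prod_congr rfl fun l _ => ?_
  push_cast
  ring

theorem poch_neg_natCast (n k : ℕ) : poch (-(n : ℂ)) k = (-1) ^ k * (n.descFactorial k : ℂ) := by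
  induction k with
  | zero => simp [poch]
  | succ k ih =>
    rw [poch_succ, ih, Nat.descFactorial_succ]
    rcases le_or_gt k n with h | h
    · push_cast [Nat.cast_sub h]
      ring
    · simp [Nat.descFactorial_of_lt h]

theorem poch_neg_natCast_eq_zero {n k : ℕ} (h : n < k) : poch (-(n : ℂ)) k = 0 := by
  simp [poch_neg_natCast, Nat.descFactorial_of_lt h]

theorem poch_neg_natCast_ne_zero {n k : ℕ} (h : k ≤ n) : poch (-(n : ℂ)) k ≠ 0 := by
  simp [poch_neg_natCast, Nat.descFactorial_eq_zero_iff_lt, h]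

theorem choose_mul_poch_div_poch {n i k : ℕ} (hki : k ≤ i) (hkn : k ≤ n) :
    (n.choose i : ℂ) * (poch (-(i : ℂ)) k / poch (-(n : ℂ)) k) = ((n - k).choose (i - k) : ℂ) := by
  rw [← mul_div_assoc, div_eq_iff (poch_neg_natCast_ne_zero hkn)]
  have h : (n.choose i : ℂ) * i.choose k = n.choose k * (n - k).choose (i - k) := by
    exact_mod_cast Nat.choose_mul hki
  simp only [poch_neg_natCast, Nat.descFactorial_eq_factorial_mul_choose, Nat.cast_mul]
  linear_combination (-1) ^ k * (k.factorial : ℂ) * h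

/-- Pascal's rule for the ratios `binom(n, i) (-i)_k / (-n)_k`. -/
theorem choose_mul_poch_div_poch_succ {n i k : ℕ} (hin : i + 1 ≤ n) (hkn : k ≤ n) :
    ((n + 1).choose (i + 1) : ℂ) * (poch (-((i + 1 : ℕ) : ℂ)) k / poch (-((n + 1 : ℕ) : ℂ)) k) =
      (n.choose (i + 1) : ℂ) * (poch (-((i + 1 : ℕ) : ℂ)) k / poch (-(n : ℂ)) k) +
        (n.choose i : ℂ) * (poch (-(i : ℂ)) k / poch (-(n : ℂ)) k) := by
  rcases lt_trichotomy k (i + 1) with h | rfl | h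
  · rw [choose_mul_poch_div_poch h.le (by lia), choose_mul_poch_div_poch h.le hkn,
      choose_mul_poch_div_poch (by lia) hkn, show n + 1 - k = n - k + 1 by lia,
      show i + 1 - k = i - k + 1 by lia, Nat.choose_succ_succ']
    push_cast
    ring
  · rw [choose_mul_poch_div_poch le_rfl (by lia), choose_mul_poch_div_poch le_rfl hkn,
      poch_neg_natCast_eq_zero (Nat.lt_succ_self i)]
    simp
  · simp [poch_neg_natCast_eq_zero h, poch_neg_natCast_eq_zero (show i < k by lia),
      -Nat.cast_add]

theorem dualHahnP_natCast (d : ℕ) (ρ σ : ℂ) (x i : ℕ) :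
    dualHahnP d ρ σ x (i : ℤ) =
      (-1 : ℂ) ^ i * poch (ρ + 1) i / poch (ρ - σ - (d : ℂ)) i *
        ∑ k ∈ Finset.range (x + 1),
          (d.choose i : ℂ) * (poch (-(i : ℂ)) k / poch (-(d : ℂ)) k) *
            (poch (-(x : ℂ)) k * poch ((x : ℂ) + 1 + σ) k /
              (poch (ρ + 1) k * (k.factorial : ℂ))) := by
  rw [dualHahnP, if_neg (by lia), Int.toNat_natCast]
  rw [Finset.sum_subset (Finset.range_subset_range.2 (show min i x + 1 ≤ x + 1 by lia))]
  · rw [Finset.mul_sum, Finset.mul_sum]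
    refine Finset.sum_congr rfl fun k _ => ?_
    simp only [div_eq_mul_inv, mul_inv]
    ring
  · intro k hk hk'
    simp only [Finset.mem_range] at hk hk'
    simp [poch_neg_natCast_eq_zero (show i < k by lia)]

theorem dualHahn_contiguity_lower (d : ℕ) (hd : 1 ≤ d) (ρ σ : ℂ)
    (hρ : ∀ m : ℕ, 1 ≤ m → m ≤ d → ρ + (m : ℂ) ≠ 0)
    (hρσ : ∀ m : ℕ, 1 ≤ m → m ≤ d → ρ - σ - (m : ℂ) ≠ 0)
    (x i : ℕ) (hx : x ≤ d - 1) (hi : i ≤ d - 1) :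
    ((d : ℂ) + σ - ρ) * dualHahnP d ρ σ x (i : ℤ) =
      -((i : ℂ) + ρ - σ - d) * dualHahnP (d - 1) ρ σ x (i : ℤ) +
        ((i : ℂ) + ρ) * dualHahnP (d - 1) ρ σ x ((i : ℤ) - 1) := by
  obtain ⟨n, rfl⟩ : ∃ n, d = n + 1 := ⟨d - 1, by lia⟩
  simp only [Nat.add_sub_cancel] at *
  rcases i with _ | i
  · rw [show dualHahnP n ρ σ x (((0 : ℕ) : ℤ) - 1) = 0 by simp [dualHahnP]]
    simp [dualHahnP, poch]
    ring
  rw [show (((i + 1 : ℕ) : ℤ) - 1) = (i : ℤ) by push_cast; ring]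
  simp only [dualHahnP_natCast]
  rw [Finset.sum_congr rfl fun k hk => by
    rw [choose_mul_poch_div_poch_succ hi (by have := Finset.mem_range.1 hk; lia), add_mul],
    Finset.sum_add_distrib]
  have hA : ρ - σ - ((n + 1 : ℕ) : ℂ) ≠ 0 := hρσ (n + 1) (by lia) le_rfl
  have hshift : ρ - σ - ((n + 1 : ℕ) : ℂ) + 1 = ρ - σ - n := by push_cast; ring
  have hlast : ρ - σ - n + i ≠ 0 := by
    have h := hρσ (n - i) (by lia) (by lia)
    rw [Nat.cast_sub (by lia)] at h
    convert h using 1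
    ring
  have hpoch : poch (ρ - σ - n) i ≠ 0 := by
    refine Finset.prod_ne_zero_iff.2 fun l hl => ?_
    have hl := Finset.mem_range.1 hl
    have h := hρσ (n - l) (by lia) (by lia)
    rw [Nat.cast_sub (by lia)] at h
    convert h using 1
    ring
  rw [poch_succ' (ρ - σ - ((n + 1 : ℕ) : ℂ)), hshift, poch_succ (ρ - σ - n), poch_succ (ρ + 1)]
  generalize poch (ρ - σ - n) i = P at *
  generalize Finset.sum (M := ℂ) (Finset.range (x + 1)) _ = S
  generalize Finset.sum (M := ℂ) (Finset.range (x + 1)) _ = T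
  push_cast at *
  field_simp
  ring
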